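/- For every m ∈ ℕ, the polytope P^(m) equals the set of α ∈ ℝ^{2m+6} satisfying Σ_{i=0}^{2m+5} α_i = m+1 together with: (i) −1/2 ≤ α_i ≤ 1 for all i; (ii) α_i ≤ 1 + α_j + α_k + α_l for all pairwise distinct i, j, k, l; (iii) α_i − α_j ≤ 1 for all i ≠ j; (iv) (|S|−2)α_i + Σ_{j∈S} α_j ≥ 0 for every i and every S ⊆ {0,…,2m+5} with i ∉ S and 3 ≤ |S| ≤ m+3. -/

import Mathlib

noncomputable section

open Finset

/-- Standard basis vector `e i` of `ℝ^(2m+6)`. -/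
def e (m : ℕ) (i : Fin (2 * m + 6)) : Fin (2 * m + 6) → ℝ := fun k => if k = i then 1 else 0

/-- The vector `ρ = (1/2, …, 1/2)` in `ℝ^(2m+6)`. -/
def ρ (m : ℕ) : Fin (2 * m + 6) → ℝ := fun _ => 1 / 2

/-- The vector `v_S = ∑_{j ∈ S} e_j`. -/
def vS (m : ℕ) (S : Finset (Fin (2 * m + 6))) : Fin (2 * m + 6) → ℝ := ∑ j ∈ S, e m j

/-- The vector `w_{ij} = ρ - e_i - e_j`. -/
def w (m : ℕ) (i j : Fin (2 * m + 6)) : Fin (2 * m + 6) → ℝ := ρ m - e m i - e m j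

/-- The polytope `P^(m)`, convex hull of all `v_S` (`|S| = m+1`) and all `w_{ij}` (`i < j`). -/
def P (m : ℕ) : Set (Fin (2 * m + 6) → ℝ) :=
  convexHull ℝ
    ({x | ∃ S : Finset (Fin (2 * m + 6)), S.card = m + 1 ∧ x = vS m S} ∪
      {x | ∃ i j : Fin (2 * m + 6), i < j ∧ x = w m i j})

/-- The polytope `P_I^(m)`, convex hull of all `v_S` with `|S| = m+1`. -/
def PI (m : ℕ) : Set (Fin (2 * m + 6) → ℝ) :=
  convexHull ℝ {x | ∃ S : Finset (Fin (2 * m + 6)), S.card = m + 1 ∧ x = vS m S}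

/-- The polytope `P_II^(m)`, convex hull of the `v_S` with `S ⊆ {1,…,2m+5}`, `|S| = m+1`,
together with the `w_{0j}` for `1 ≤ j ≤ 2m+5`. -/
def PII (m : ℕ) : Set (Fin (2 * m + 6) → ℝ) :=
  convexHull ℝ
    ({x | ∃ S : Finset (Fin (2 * m + 6)), S.card = m + 1 ∧ (0 : Fin (2 * m + 6)) ∉ S ∧ x = vS m S} ∪
      {x | ∃ j : Fin (2 * m + 6), j ≠ 0 ∧ x = w m 0 j})

/-- The polytope `P_III^(m)`, convex hull of the `v_S` with `S ⊆ {3,…,2m+5}`, `|S| = m+1`,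
together with the `w_{ij}` for `0 ≤ i < j ≤ 2`. -/
def PIII (m : ℕ) : Set (Fin (2 * m + 6) → ℝ) :=
  convexHull ℝ
    ({x | ∃ S : Finset (Fin (2 * m + 6)), S.card = m + 1 ∧ (∀ s ∈ S, 3 ≤ (s : ℕ)) ∧ x = vS m S} ∪
      {x | ∃ i j : Fin (2 * m + 6), (i : ℕ) < (j : ℕ) ∧ (j : ℕ) ≤ 2 ∧ x = w m i j})

section Hypersimplex

variable {ι : Type*} [Fintype ι] [DecidableEq ι]

/-- The indices at which `x` takes a value strictly between `0` and `1`. -/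
def fractionalSupport (x : ι → ℝ) : Finset ι := {k | 0 < x k ∧ x k < 1}

lemma exists_second_fractional {x : ι → ℝ} {q : ℕ} (hx : ∀ k, 0 ≤ x k ∧ x k ≤ 1)
    (hs : ∑ k, x k = q) {a : ι} (ha : a ∈ fractionalSupport x) :
    ∃ b ∈ fractionalSupport x, b ≠ a := by
  by_contra! h
  have hint : ∀ k ∈ univ.erase a, x k = if x k = 1 then 1 else 0 := by
    intro k hk
    split_ifs with h1
    · exact h1
    · by_contra h0
      refine (mem_erase.1 hk).1 (h k ?_)
      simp only [fractionalSupport, mem_filter, mem_univ, true_and]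
      exact ⟨lt_of_le_of_ne (hx k).1 (Ne.symm h0), lt_of_le_of_ne (hx k).2 h1⟩
  have hsum := add_sum_erase univ x (mem_univ a)
  rw [sum_congr rfl hint, sum_boole, hs] at hsum
  simp only [fractionalSupport, mem_filter, mem_univ, true_and] at ha
  set r := #{k ∈ univ.erase a | x k = 1}
  have h1 : (r : ℝ) < q := by linarith
  have h2 : (q : ℝ) < (r + 1 : ℕ) := by push_cast; linarith
  norm_cast at h1 h2
  lia

/-- Moving mass from `b` to `a` as far as the unit cube allows removes a fractional coordinate. -/
lemma exists_shift {x : ι → ℝ} (hx : ∀ k, 0 ≤ x k ∧ x k ≤ 1) {a b : ι}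
    (ha : a ∈ fractionalSupport x) (hb : b ∈ fractionalSupport x) (hab : b ≠ a) :
    ∃ d : ℝ, 0 < d ∧
      (∀ k, 0 ≤ (x + d • (Pi.single a 1 - Pi.single b 1 : ι → ℝ)) k ∧
        (x + d • (Pi.single a 1 - Pi.single b 1 : ι → ℝ)) k ≤ 1) ∧
      #(fractionalSupport (x + d • (Pi.single a 1 - Pi.single b 1 : ι → ℝ))) <
        #(fractionalSupport x) := by
  have ha' := ha
  have hb' := hb
  simp only [fractionalSupport, mem_filter, mem_univ, true_and] at ha' hb'
  set d := min (1 - x a) (x b) with hd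
  have hd0 : 0 < d := lt_min (by linarith) hb'.1
  have hd1 : d ≤ 1 - x a := min_le_left _ _
  have hd2 : d ≤ x b := min_le_right _ _
  set y := x + d • (Pi.single a 1 - Pi.single b 1 : ι → ℝ) with hy
  have hya : y a = x a + d := by simp [hy, hab.symm]
  have hyb : y b = x b - d := by simp [hy, hab]; ring
  have hyk : ∀ k, k ≠ a → k ≠ b → y k = x k := by
    intro k h1 h2
    simp [hy, h1, h2]
  refine ⟨d, hd0, ?_⟩
  change (∀ k, 0 ≤ y k ∧ y k ≤ 1) ∧ #(fractionalSupport y) < #(fractionalSupport x)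
  refine ⟨fun k => ?_, card_lt_card ?_⟩
  · by_cases h1 : k = a
    · subst h1; rw [hya]; constructor <;> linarith
    by_cases h2 : k = b
    · subst h2; rw [hyb]; constructor <;> linarith
    rw [hyk k h1 h2]; exact hx k
  · rw [ssubset_iff_of_subset]
    · rcases min_choice (1 - x a) (x b) with h | h
      · refine ⟨a, ha, ?_⟩
        simp only [fractionalSupport, mem_filter, mem_univ, true_and, hya]
        intro h'; linarith
      · refine ⟨b, hb, ?_⟩
        simp only [fractionalSupport, mem_filter, mem_univ, true_and, hyb]
        intro h'; linarith
    · intro k hk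
      by_cases h1 : k = a
      · rwa [h1]
      by_cases h2 : k = b
      · rwa [h2]
      simpa only [fractionalSupport, mem_filter, mem_univ, true_and, hyk k h1 h2] using hk

/-- The hypersimplex `{x ∈ [0,1]^ι | ∑ x = q}` is contained in every convex set which contains
its `0/1`-points. -/
lemma mem_of_hypersimplex {C : Set (ι → ℝ)} (hC : Convex ℝ C) {q : ℕ}
    (hv : ∀ S : Finset ι, #S = q → (fun k => if k ∈ S then 1 else 0) ∈ C)
    {x : ι → ℝ} (hx : ∀ k, 0 ≤ x k ∧ x k ≤ 1) (hs : ∑ k, x k = q) : x ∈ C := by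
  induction hN : #(fractionalSupport x) using Nat.strong_induction_on generalizing x with
  | _ N ih =>
  rcases (fractionalSupport x).eq_empty_or_nonempty with he | ⟨a, ha⟩
  · have hint : ∀ k, x k = if k ∈ ({k | x k = 1} : Finset ι) then 1 else 0 := by
      intro k
      simp only [mem_filter, mem_univ, true_and]
      split_ifs with h1
      · exact h1
      · by_contra h0
        have : k ∈ fractionalSupport x := by
          simp only [fractionalSupport, mem_filter, mem_univ, true_and]
          exact ⟨lt_of_le_of_ne (hx k).1 (Ne.symm h0), lt_of_le_of_ne (hx k).2 h1⟩
        simp [he] at this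
    rw [funext hint]
    refine hv _ ?_
    rw [sum_congr rfl fun k _ => hint k, sum_boole] at hs
    simpa using hs
  · obtain ⟨b, hb, hab⟩ := exists_second_fractional hx hs ha
    obtain ⟨d, hd, hy, hyN⟩ := exists_shift hx ha hb hab
    obtain ⟨d', hd', hz, hzN⟩ := exists_shift hx hb ha hab.symm
    have hy' := ih _ (hN ▸ hyN) hy (by simp [sum_add_distrib, ← mul_sum, hs]) rfl
    have hz' := ih _ (hN ▸ hzN) hz (by simp [sum_add_distrib, ← mul_sum, hs]) rfl
    have := hC hy' hz' (a := d' / (d + d')) (b := d / (d + d')) (by positivity) (by positivity)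
      (by field_simp; ring)
    convert this using 1
    ext k
    simp only [Pi.add_apply, Pi.smul_apply, Pi.sub_apply, smul_eq_mul]
    field_simp
    ring

end Hypersimplex

/-- A vector with prescribed sum exists between two vectors whose sums enclose it. -/
lemma exists_between_of_sum {ι : Type*} (s : Finset ι) {lo up : ι → ℝ} {C : ℝ}
    (h : ∀ k ∈ s, lo k ≤ up k) (h1 : ∑ k ∈ s, lo k ≤ C) (h2 : C ≤ ∑ k ∈ s, up k) :
    ∃ c : ι → ℝ, (∀ k ∈ s, lo k ≤ c k ∧ c k ≤ up k) ∧ ∑ k ∈ s, c k = C := by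
  have hC : C ∈ segment ℝ (∑ k ∈ s, lo k) (∑ k ∈ s, up k) := by
    rw [segment_eq_Icc (h1.trans h2)]
    exact ⟨h1, h2⟩
  obtain ⟨a, b, ha, hb, hab, rfl⟩ := hC
  refine ⟨fun k => a * lo k + b * up k, fun k hk => ?_, ?_⟩
  · have := h k hk
    obtain rfl : a = 1 - b := by linarith
    constructor <;> nlinarith
  · simp [sum_add_distrib, mul_sum]

lemma vS_apply (m : ℕ) (S : Finset (Fin (2 * m + 6))) (k : Fin (2 * m + 6)) :
    vS m S k = if k ∈ S then 1 else 0 := by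
  simp [vS, e, Finset.sum_apply]

lemma w_apply (m : ℕ) (i j k : Fin (2 * m + 6)) :
    w m i j k = 1 / 2 - (if k = i then 1 else 0) - (if k = j then 1 else 0) := rfl

lemma convex_P (m : ℕ) : Convex ℝ (P m) := convex_convexHull ℝ _

lemma w_mem_P (m : ℕ) {i j : Fin (2 * m + 6)} (h : i ≠ j) : w m i j ∈ P m := by
  apply subset_convexHull
  right
  rcases lt_or_gt_of_ne h with h | h
  · exact ⟨i, j, h, rfl⟩
  · exact ⟨j, i, h, by simp only [w]; abel⟩

lemma hypersimplex_mem_P (m : ℕ) {x : Fin (2 * m + 6) → ℝ} (hx : ∀ k, 0 ≤ x k ∧ x k ≤ 1)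
    (hs : ∑ k, x k = m + 1) : x ∈ P m := by
  refine mem_of_hypersimplex (convex_P m) (q := m + 1) (fun S hS => ?_) hx (by simpa using hs)
  exact subset_convexHull _ _ (Or.inl ⟨S, hS, (funext (vS_apply m S)).symm⟩)

/-- A point of a dilated hypersimplex is a multiple of a point of `P m`. -/
lemma exists_smul_eq (m : ℕ) {β : Fin (2 * m + 6) → ℝ} {t : ℝ} (ht : 0 ≤ t)
    (hβ : ∀ k, 0 ≤ β k ∧ β k ≤ t) (hs : ∑ k, β k = (m + 1) * t) :
    ∃ h ∈ P m, t • h = β := by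
  rcases ht.eq_or_lt with rfl | ht
  · refine ⟨w m 0 1, w_mem_P m (by simp), ?_⟩
    ext k
    simpa using le_antisymm (hβ k).1 (hβ k).2
  · refine ⟨t⁻¹ • β, hypersimplex_mem_P m (fun k => ?_) ?_, smul_inv_smul₀ ht.ne' β⟩
    · have := hβ k
      simp only [Pi.smul_apply, smul_eq_mul]
      rw [inv_mul_le_iff₀ ht, mul_one]
      exact ⟨mul_nonneg (inv_nonneg.2 ht.le) this.1, this.2⟩
    · simp only [Pi.smul_apply, smul_eq_mul, ← mul_sum, hs]
      field_simp

lemma sum_w (m : ℕ) (i j : Fin (2 * m + 6)) : ∑ k, w m i j k = m + 1 := by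
  simp only [w_apply, sum_sub_distrib, sum_const, card_univ, Fintype.card_fin, sum_ite_eq',
    mem_univ, if_true, nsmul_eq_mul]
  push_cast
  ring

/-- A point is in `P m` if subtracting a nonnegative combination of the vertices `w` leaves a
point of the complementary dilate of the hypersimplex. -/
lemma mem_P_of_weights (m : ℕ) {α : Fin (2 * m + 6) → ℝ} (hα : ∑ k, α k = m + 1)
    {κ : Type*} (s : Finset κ) {p q : κ → Fin (2 * m + 6)} {c : κ → ℝ} {t : ℝ}
    (hpq : ∀ k ∈ s, p k ≠ q k) (hc : ∀ k ∈ s, 0 ≤ c k) (ht : 0 ≤ t) (hct : ∑ k ∈ s, c k + t = 1)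
    (hβ : ∀ l, 0 ≤ α l - ∑ k ∈ s, c k * w m (p k) (q k) l ∧
      α l - ∑ k ∈ s, c k * w m (p k) (q k) l ≤ t) : α ∈ P m := by
  obtain ⟨x, hx, hxβ⟩ := exists_smul_eq m ht hβ (by
    rw [sum_sub_distrib, sum_comm]
    simp only [← mul_sum, sum_w, ← sum_mul, hα]
    linear_combination (-(m : ℝ) - 1) * hct)
  have := (convex_P m).sum_mem (t := insertNone s) (w := fun o => o.elim t c)
    (z := fun o => o.elim x fun k => w m (p k) (q k)) ?_ ?_ ?_
  · convert this using 1
    rw [sum_insertNone]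
    ext l
    simp [hxβ, Finset.sum_apply]
  · exact forall_mem_insertNone.2 ⟨ht, hc⟩
  · rw [sum_insertNone]
    simpa [add_comm] using hct
  · exact forall_mem_insertNone.2 ⟨hx, fun k hk => w_mem_P m (hpq k hk)⟩

/-- The half-space description of `P m`. -/
structure SatisfiesInequalities (m : ℕ) (α : Fin (2 * m + 6) → ℝ) : Prop where
  sum_eq : ∑ i, α i = (m : ℝ) + 1
  bounds : ∀ i, -(1 / 2) ≤ α i ∧ α i ≤ 1
  le_add_three : ∀ i j k l : Fin (2 * m + 6), i ≠ j → i ≠ k → i ≠ l → j ≠ k → j ≠ l → k ≠ l →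
    α i ≤ 1 + α j + α k + α l
  sub_le : ∀ i j : Fin (2 * m + 6), i ≠ j → α i - α j ≤ 1
  subset_nonneg : ∀ i : Fin (2 * m + 6), ∀ S : Finset (Fin (2 * m + 6)),
    i ∉ S → 3 ≤ S.card → S.card ≤ m + 3 → 0 ≤ ((S.card : ℝ) - 2) * α i + ∑ j ∈ S, α j

lemma convex_satisfiesInequalities (m : ℕ) : Convex ℝ {α | SatisfiesInequalities m α} := by
  intro x hx y hy a b ha hb hab
  refine ⟨?_, fun i => ?_, fun i j k l h1 h2 h3 h4 h5 h6 => ?_, fun i j h => ?_,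
    fun i S h1 h2 h3 => ?_⟩ <;>
    simp only [Pi.add_apply, Pi.smul_apply, smul_eq_mul, sum_add_distrib, ← mul_sum]
  · rw [hx.sum_eq, hy.sum_eq, ← add_mul, hab, one_mul]
  · obtain ⟨p, p'⟩ := hx.bounds i
    obtain ⟨q, q'⟩ := hy.bounds i
    obtain rfl : a = 1 - b := by linarith
    constructor <;> nlinarith
  · have p := hx.le_add_three i j k l h1 h2 h3 h4 h5 h6
    have q := hy.le_add_three i j k l h1 h2 h3 h4 h5 h6
    linarith [mul_le_mul_of_nonneg_left p ha, mul_le_mul_of_nonneg_left q hb]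
  · have p := hx.sub_le i j h
    have q := hy.sub_le i j h
    linarith [mul_le_mul_of_nonneg_left p ha, mul_le_mul_of_nonneg_left q hb]
  · have p := hx.subset_nonneg i S h1 h2 h3
    have q := hy.subset_nonneg i S h1 h2 h3
    linarith [mul_nonneg ha p, mul_nonneg hb q]

lemma satisfiesInequalities_vS (m : ℕ) {S : Finset (Fin (2 * m + 6))} (hS : #S = m + 1) :
    SatisfiesInequalities m (vS m S) := by
  have h0 : ∀ k, 0 ≤ vS m S k := fun k => by rw [vS_apply]; split_ifs <;> norm_num
  have h1 : ∀ k, vS m S k ≤ 1 := fun k => by rw [vS_apply]; split_ifs <;> norm_num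
  refine ⟨?_, fun i => ⟨by linarith [h0 i], h1 i⟩, fun i j k l _ _ _ _ _ _ => ?_,
    fun i j _ => ?_, fun i T _ h3 _ => ?_⟩
  · simp [vS_apply, hS]
  · linarith [h1 i, h0 j, h0 k, h0 l]
  · linarith [h1 i, h0 j]
  · have : (3 : ℝ) ≤ #T := by exact_mod_cast h3
    exact add_nonneg (mul_nonneg (by linarith) (h0 i)) (sum_nonneg fun j _ => h0 j)

lemma satisfiesInequalities_w (m : ℕ) {a b : Fin (2 * m + 6)} (hab : a ≠ b) :
    SatisfiesInequalities m (w m a b) := by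
  refine ⟨?_, fun i => ?_, fun i j k l _ _ _ _ _ _ => ?_, fun i j _ => ?_, fun i T hi h3 _ => ?_⟩
  · exact sum_w m a b
  · rw [w_apply]
    split_ifs with h h' <;> first | (exfalso; grind) | norm_num
  · simp only [w_apply]
    split_ifs <;> first | (exfalso; grind) | norm_num
  · simp only [w_apply]
    split_ifs <;> first | (exfalso; grind) | norm_num
  · have h3' : (3 : ℝ) ≤ #T := by exact_mod_cast h3
    simp only [w_apply, sum_sub_distrib, sum_const, sum_ite_eq', nsmul_eq_mul]
    split_ifs <;> first | (exfalso; grind) | linarith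

/-- The case in which three coordinates have negative pairwise sums. -/
lemma mem_P_of_three_neg (m : ℕ) {α : Fin (2 * m + 6) → ℝ} (h : SatisfiesInequalities m α)
    {i j k : Fin (2 * m + 6)} (hij : i ≠ j) (hik : i ≠ k) (hjk : j ≠ k)
    (nij : α i + α j ≤ 0) (nik : α i + α k ≤ 0) (njk : α j + α k ≤ 0) : α ∈ P m := by
  set s := α i + α j + α k with hs
  have hlow : ∀ l, l ≠ i → l ≠ j → l ≠ k → 0 ≤ α l + s ∧ α l + s ≤ 1 + 2 * s := by
    intro l hi hj hk
    have h1 := h.le_add_three l i j k hi hj hk hij hik hjk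
    have hcard : #({i, j, k} : Finset (Fin (2 * m + 6))) = 3 := card_eq_three.2
      ⟨i, j, k, hij, hik, hjk, rfl⟩
    have h2 := h.subset_nonneg l {i, j, k} (by simp [hi, hj, hk]) hcard.ge (by lia)
    rw [hcard, sum_insert (by simp [hij, hik]), sum_pair hjk] at h2
    norm_num at h2
    constructor <;> linarith
  have ht : 0 ≤ 1 + 2 * s := by
    obtain ⟨l, hl⟩ : ∃ l, l ∉ ({i, j, k} : Finset (Fin (2 * m + 6))) := by
      by_contra! hall
      have h1 := card_le_card (fun x _ => hall x : univ ⊆ ({i, j, k} : Finset (Fin (2 * m + 6))))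
      have h2 := card_le_three (a := i) (b := j) (c := k)
      rw [card_univ, Fintype.card_fin] at h1
      lia
    simp only [mem_insert, mem_singleton, not_or] at hl
    have := hlow l hl.1 hl.2.1 hl.2.2
    linarith
  refine mem_P_of_weights m h.sum_eq (univ : Finset (Fin 3)) (p := ![j, i, i]) (q := ![k, k, j])
    (c := ![-(α j + α k), -(α i + α k), -(α i + α j)]) ?_ ?_ ht ?_ fun l => ?_
  · intro x _
    fin_cases x <;> simpa
  · intro x _
    fin_cases x <;> simp <;> linarith
  · simp [Fin.sum_univ_three]
    linarith
  · simp only [Fin.sum_univ_three, w_apply, Matrix.cons_val]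
    by_cases hi : l = i
    · subst hi
      simp only [hij, hik, if_true, if_false]
      constructor <;> linarith
    by_cases hj : l = j
    · subst hj
      simp only [hij.symm, hjk, if_true, if_false]
      constructor <;> linarith
    by_cases hk : l = k
    · subst hk
      simp only [hik.symm, hjk.symm, if_true, if_false]
      constructor <;> linarith
    obtain ⟨h1, h2⟩ := hlow l hi hj hk
    simp only [hi, hj, hk, if_false]
    constructor <;> linarith

/-- The subset inequality at a minimal coordinate, for subsets of any size. -/
lemma subset_nonneg_of_min (m : ℕ) {α : Fin (2 * m + 6) → ℝ} (h : SatisfiesInequalities m α)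
    {i : Fin (2 * m + 6)} (hmin : ∀ k, α i ≤ α k) (hneg : α i ≤ 0)
    (hpair : ∀ k l, k ≠ i → l ≠ i → k ≠ l → 0 ≤ α k + α l)
    {T : Finset (Fin (2 * m + 6))} (hT : i ∉ T) : 0 ≤ ((#T : ℝ) - 2) * α i + ∑ j ∈ T, α j := by
  have hcases : #T = 0 ∨ #T = 1 ∨ #T = 2 ∨ 3 ≤ #T := by lia
  rcases hcases with h0 | h1 | h2 | h3
  · obtain rfl := card_eq_zero.1 h0
    simp
    linarith
  · obtain ⟨k, rfl⟩ := card_eq_one.1 h1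
    simp
    linarith [hmin k]
  · obtain ⟨k, l, hkl, rfl⟩ := card_eq_two.1 h2
    simp only [mem_insert, mem_singleton, not_or] at hT
    rw [h2, sum_pair hkl]
    push_cast
    linarith [hpair k l (Ne.symm hT.1) (Ne.symm hT.2) hkl]
  by_cases h4 : #T ≤ m + 3
  · exact h.subset_nonneg i T hT h3 h4
  have hU : ∑ k ∈ (insert i T)ᶜ, α k ≤ #(insert i T)ᶜ • (1 + α i) := by
    refine sum_le_card_nsmul _ _ _ fun k hk => ?_
    have hki : k ≠ i := by
      rintro rfl
      simp at hk
    linarith [h.sub_le k i hki]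
  have hcard : (#(insert i T)ᶜ : ℝ) = 2 * m + 5 - #T := by
    have := card_compl_add_card (insert i T)
    rw [card_insert_of_notMem hT, Fintype.card_fin] at this
    have h' : ((#(insert i T)ᶜ + (#T + 1) : ℕ) : ℝ) = (2 * m + 6 : ℕ) := congrArg _ this
    push_cast at h'
    linarith
  have hsum := sum_add_sum_compl (insert i T) α
  rw [sum_insert hT, h.sum_eq] at hsum
  rw [nsmul_eq_mul, hcard] at hU
  have h5 : (m : ℝ) + 4 ≤ #T := by
    have : m + 4 ≤ #T := by lia
    exact_mod_cast this
  nlinarith [mul_nonneg (sub_nonneg.2 h5) (by linarith [(h.bounds i).1] : 0 ≤ 1 + 2 * α i)]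

/-- The case in which only one coordinate matters: all pairs avoiding a minimal coordinate have
nonnegative sum. -/
lemma mem_P_of_min (m : ℕ) {α : Fin (2 * m + 6) → ℝ} (h : SatisfiesInequalities m α)
    {i : Fin (2 * m + 6)} (hmin : ∀ k, α i ≤ α k) (hneg : α i ≤ 0)
    (hpair : ∀ k l, k ≠ i → l ≠ i → k ≠ l → 0 ≤ α k + α l) : α ∈ P m := by
  have hb := (h.bounds i).1
  have hcard : (#(univ.erase i) : ℝ) = 2 * m + 5 := by
    rw [card_erase_of_mem (mem_univ i), card_univ, Fintype.card_fin]
    push_cast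
    ring
  have hsum := add_sum_erase univ α (mem_univ i)
  rw [h.sum_eq] at hsum
  set lo : Fin (2 * m + 6) → ℝ := fun k => if 0 ≤ -α i - α k then -α i - α k else 0 with hlo
  set up : Fin (2 * m + 6) → ℝ := fun k => 1 + α i - α k with hup
  have hle : ∀ k ∈ univ.erase i, lo k ≤ up k := by
    intro k hk
    have := h.sub_le k i (ne_of_mem_erase hk)
    simp only [hlo, hup]
    split_ifs <;> linarith
  have hlosum : ∑ k ∈ univ.erase i, lo k ≤ -2 * α i := by
    have := subset_nonneg_of_min m h hmin hneg hpair
      (T := {k ∈ univ.erase i | 0 ≤ -α i - α k}) (by simp)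
    rw [← sum_filter, sum_sub_distrib, sum_const, nsmul_eq_mul]
    linarith
  have hupsum : -2 * α i ≤ ∑ k ∈ univ.erase i, up k := by
    rw [sum_sub_distrib, sum_const, nsmul_eq_mul, hcard]
    have : (0 : ℝ) ≤ m := Nat.cast_nonneg m
    nlinarith [mul_nonneg this (by linarith : 0 ≤ 1 + 2 * α i)]
  obtain ⟨c, hc, hcs⟩ := exists_between_of_sum (univ.erase i) hle hlosum hupsum
  refine mem_P_of_weights m h.sum_eq (univ.erase i) (p := fun _ => i) (q := id) (c := c)
    (t := 1 + 2 * α i) (fun k hk => (ne_of_mem_erase hk).symm) (fun k hk => ?_) (by linarith)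
    (by linarith) fun l => ?_
  · refine le_trans ?_ (hc k hk).1
    simp only [hlo]
    split_ifs with h0
    · exact h0
    · exact le_rfl
  · simp only [w_apply, mul_sub, sum_sub_distrib, ← sum_mul, hcs, id, mul_ite, mul_one,
      mul_zero, sum_ite_eq]
    by_cases hl : l = i
    · subst hl
      simp only [notMem_erase, if_true, if_false, hcs]
      constructor <;> linarith
    · have hl' : l ∈ univ.erase i := mem_erase.2 ⟨hl, mem_univ l⟩
      have := hc l hl'
      simp only [hl', hl, if_true, if_false, sum_const_zero]
      simp only [hlo, hup] at this
      constructor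
      · split_ifs at this <;> linarith
      · linarith

lemma mem_P_of_satisfiesInequalities (m : ℕ) {α : Fin (2 * m + 6) → ℝ}
    (h : SatisfiesInequalities m α) : α ∈ P m := by
  obtain ⟨i, hmin⟩ := Finite.exists_min α
  rcases le_or_gt 0 (α i) with hpos | hneg
  · exact hypersimplex_mem_P m (fun k => ⟨hpos.trans (hmin k), (h.bounds k).2⟩) h.sum_eq
  by_cases hpair : ∀ k l, k ≠ i → l ≠ i → k ≠ l → 0 ≤ α k + α l
  · exact mem_P_of_min m h hmin hneg.le hpair
  · push Not at hpair
    obtain ⟨k, l, hk, hl, hkl, hsum⟩ := hpair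
    exact mem_P_of_three_neg m h hk.symm hl.symm hkl (by linarith [hmin l])
      (by linarith [hmin k]) hsum.le

theorem statement7 (m : ℕ) :
    P m =
      {α : Fin (2 * m + 6) → ℝ |
        (∑ i, α i) = (m : ℝ) + 1 ∧
        (∀ i, -(1 / 2) ≤ α i ∧ α i ≤ 1) ∧
        (∀ i j k l : Fin (2 * m + 6), i ≠ j → i ≠ k → i ≠ l → j ≠ k → j ≠ l → k ≠ l →
          α i ≤ 1 + α j + α k + α l) ∧
        (∀ i j : Fin (2 * m + 6), i ≠ j → α i - α j ≤ 1) ∧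
        (∀ i : Fin (2 * m + 6), ∀ S : Finset (Fin (2 * m + 6)),
          i ∉ S → 3 ≤ S.card → S.card ≤ m + 3 →
            0 ≤ ((S.card : ℝ) - 2) * α i + ∑ j ∈ S, α j)} := by
  apply Set.Subset.antisymm
  · have hsub : P m ⊆ {α | SatisfiesInequalities m α} := by
      refine convexHull_min ?_ (convex_satisfiesInequalities m)
      rintro x (⟨S, hS, rfl⟩ | ⟨i, j, hij, rfl⟩)
      · exact satisfiesInequalities_vS m hS
      · exact satisfiesInequalities_w m hij.ne
    intro α hα
    have h := hsub hα
    exact ⟨h.sum_eq, h.bounds, h.le_add_three, h.sub_le, h.subset_nonneg⟩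
  · rintro α ⟨h1, h2, h3, h4, h5⟩
    exact mem_P_of_satisfiesInequalities m ⟨h1, h2, h3, h4, h5⟩
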